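/- arXiv:1710.07894 — 4 statements merged into one kernel-verified Lean document; each statement's English description precedes it below -/
import Mathlib

section
/- Let T > 0 and let ω̃ : [0,T] → ℝ be arbitrary. Let 0 = t_0 < t_1 < … < t_N = T and let g : [0,T] → ℝ be a step function which is constant on each interval [t_{i-1}, t_i), i = 1, …, N, with value g(t_{i-1}). Let τ = {0 = τ_0 < τ_1 < … < τ_k = T} be a finite partition of [0,T], and for t ∈ [0,T] write τ(t) := min{ τ_j : τ_j ≥ t }. Assume that for each i ∈ {1, …, N−1} one has t_i ≤ τ(t_i) < t_{i+1}. Then Σ_{j=1}^{k} g(τ_{j-1})·(ω̃(τ_j) − ω̃(τ_{j-1})) = Σ_{i=1}^{N} g(t_{i-1})·(ω̃(t_i) − ω̃(t_{i-1})) − Σ_{i=2}^{N} (g(t_{i-1}) − g(t_{i-2}))·(ω̃(τ(t_{i-1})) − ω̃(t_{i-1})). -/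
open Set Filter

/-- Rearrangement identity for Riemann–Stieltjes sums of a step-function integrand
(Step 3 of the proof of Lemma 6). Here `τof s = min { τ j : τ j ≥ s }`. -/
theorem stmt1 (T : ℝ) (hT : 0 < T) (ωt : ℝ → ℝ)
    (N : ℕ) (hN : 1 ≤ N) (t : ℕ → ℝ)
    (ht0 : t 0 = 0) (htN : t N = T)
    (htmono : ∀ i j : ℕ, i < j → j ≤ N → t i < t j)
    (g : ℝ → ℝ)
    (hg : ∀ i ∈ Finset.Icc 1 N, ∀ s ∈ Set.Ico (t (i - 1)) (t i), g s = g (t (i - 1)))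
    (k : ℕ) (hk : 1 ≤ k) (τ : ℕ → ℝ)
    (hτ0 : τ 0 = 0) (hτk : τ k = T)
    (hτmono : ∀ i j : ℕ, i < j → j ≤ k → τ i < τ j)
    (τof : ℝ → ℝ)
    (hτof : ∀ s ∈ Set.Icc (0 : ℝ) T,
      (∃ j ≤ k, τof s = τ j) ∧ s ≤ τof s ∧ ∀ j ≤ k, s ≤ τ j → τof s ≤ τ j)
    (hloc : ∀ i ∈ Finset.Icc 1 (N - 1), t i ≤ τof (t i) ∧ τof (t i) < t (i + 1)) :
    ∑ j ∈ Finset.Icc 1 k, g (τ (j - 1)) * (ωt (τ j) - ωt (τ (j - 1)))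
      = (∑ i ∈ Finset.Icc 1 N, g (t (i - 1)) * (ωt (t i) - ωt (t (i - 1))))
        - ∑ i ∈ Finset.Icc 2 N,
            (g (t (i - 1)) - g (t (i - 2))) * (ωt (τof (t (i - 1))) - ωt (t (i - 1))) := by
  have htle : ∀ i j : ℕ, i ≤ j → j ≤ N → t i ≤ t j := by
    intro i j h hj
    rcases h.eq_or_lt with rfl | h
    · exact le_rfl
    · exact (htmono i j h hj).le
  have hτle : ∀ i j : ℕ, i ≤ j → j ≤ k → τ i ≤ τ j := by
    intro i j h hj
    rcases h.eq_or_lt with rfl | h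
    · exact le_rfl
    · exact (hτmono i j h hj).le
  have hmem : ∀ i ≤ N, t i ∈ Set.Icc (0 : ℝ) T := fun i hi =>
    ⟨ht0 ▸ htle 0 i (Nat.zero_le _) hi, htN ▸ htle i N hi le_rfl⟩
  have hex : ∀ i, ∃ j, i ≤ N → j ≤ k ∧ τof (t i) = τ j := by
    intro i
    by_cases hi : i ≤ N
    · obtain ⟨j, hj, h⟩ := (hτof _ (hmem i hi)).1
      exact ⟨j, fun _ => ⟨hj, h⟩⟩
    · exact ⟨0, fun h => absurd h hi⟩
  choose m hm using hex
  have hge : ∀ i ≤ N, t i ≤ τ (m i) := fun i hi => by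
    rw [← (hm i hi).2]; exact (hτof _ (hmem i hi)).2.1
  have hmin : ∀ i ≤ N, ∀ j ≤ k, t i ≤ τ j → m i ≤ j := by
    intro i hi j hj h
    have h1 := (hτof _ (hmem i hi)).2.2 j hj h
    rw [(hm i hi).2] at h1
    by_contra hlt
    exact absurd (hτmono j (m i) (not_le.mp hlt) (hm i hi).1) (not_lt.mpr h1)
  have hm0 : m 0 = 0 := Nat.le_zero.mp (hmin 0 (Nat.zero_le _) 0 (Nat.zero_le _) (by rw [ht0, hτ0]))
  have hmN : m N = k := by
    apply le_antisymm (hm N le_rfl).1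
    by_contra hlt
    have h1 := hτmono (m N) k (not_le.mp hlt) le_rfl
    have h2 := hge N le_rfl
    rw [htN] at h2
    rw [hτk] at h1
    linarith
  have key : ∀ n ≤ N, ∑ j ∈ Finset.range (m n), g (τ j) * (ωt (τ (j + 1)) - ωt (τ j))
      = (∑ i ∈ Finset.range n, g (t i) * (ωt (t (i + 1)) - ωt (t i)))
        - (∑ i ∈ Finset.range n, (g (t i) - g (t (i - 1))) * (ωt (τ (m i)) - ωt (t i)))
        + g (t (n - 1)) * (ωt (τ (m n)) - ωt (t n)) := by
    intro n
    induction n with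
    | zero => intro _; simp [hm0, ht0, hτ0]
    | succ n ih =>
      intro hn
      have hn' : n ≤ N := by omega
      have hle : m n ≤ m (n + 1) := hmin n hn' _ (hm _ hn).1
        ((htle n (n + 1) (by omega) hn).trans (hge _ hn))
      have hblock : ∑ j ∈ Finset.Ico (m n) (m (n + 1)), g (τ j) * (ωt (τ (j + 1)) - ωt (τ j))
          = g (t n) * (ωt (τ (m (n + 1))) - ωt (τ (m n))) := by
        rw [← Finset.sum_Ico_sub (fun j => ωt (τ j)) hle, Finset.mul_sum]
        apply Finset.sum_congr rfl
        intro j hj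
        rw [Finset.mem_Ico] at hj
        have hjk : j ≤ k := hj.2.le.trans (hm _ hn).1
        rw [hg (n + 1) (Finset.mem_Icc.mpr ⟨by omega, hn⟩) (τ j) ⟨?_, ?_⟩]
        · simp
        · simpa using (hge n hn').trans (hτle _ _ hj.1 hjk)
        · by_contra h
          have := hmin (n + 1) hn j hjk (not_lt.mp h)
          omega
      rw [← Finset.sum_range_add_sum_Ico _ hle, hblock, ih hn', Finset.sum_range_succ,
        Finset.sum_range_succ]
      simp only [Nat.add_sub_cancel]
      ring
  have hK := key N le_rfl
  have conv : ∀ (f : ℕ → ℝ) (n : ℕ), ∑ i ∈ Finset.Icc 1 n, f i = ∑ i ∈ Finset.range n, f (i + 1) := by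
    intro f n
    rw [Finset.range_eq_Ico, Finset.sum_Ico_add' f 0 n 1]
    rfl
  have h2 : ∑ i ∈ Finset.Icc 2 N,
      (g (t (i - 1)) - g (t (i - 2))) * (ωt (τof (t (i - 1))) - ωt (t (i - 1)))
      = ∑ i ∈ Finset.range N, (g (t i) - g (t (i - 1))) * (ωt (τ (m i)) - ωt (t i)) := by
    have : ∑ i ∈ Finset.Icc 2 N,
      (g (t (i - 1)) - g (t (i - 2))) * (ωt (τof (t (i - 1))) - ωt (t (i - 1)))
      = ∑ i ∈ Finset.Icc 1 N,
      (g (t (i - 1)) - g (t (i - 2))) * (ωt (τof (t (i - 1))) - ωt (t (i - 1))) := by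
      apply Finset.sum_subset (Finset.Icc_subset_Icc_left (by omega))
      intro i hi hi'
      rw [Finset.mem_Icc] at hi hi'
      have : i = 1 := by omega
      subst this
      simp
    rw [this, conv]
    apply Finset.sum_congr rfl
    intro i hi
    rw [Finset.mem_range] at hi
    rw [show i + 1 - 2 = i - 1 by omega, Nat.add_sub_cancel, (hm i hi.le).2]
  rw [h2, conv, conv]
  simp only [Nat.add_sub_cancel]
  rw [hmN, hτk, htN] at hK
  simpa using hK
end

section
/- Let T > 0 and let ω̃ : [0,T] → ℝ be càdlàg. Let 0 = t_0 < t_1 < … < t_N = T and let g : [0,T] → ℝ be a step function which is constant on each interval [t_{i-1}, t_i), i = 1, …, N, with value g(t_{i-1}). For each n ∈ ℕ let τⁿ = {0 = τ_0ⁿ < τ_1ⁿ < … < τ_{k_n}ⁿ = T} be a finite partition of [0,T], and write τⁿ(t) := min{ τ_jⁿ : τ_jⁿ ≥ t }. Assume that for each i ∈ {1, …, N−1} one has lim_{n→∞} τⁿ(t_i) = t_i. Then lim_{n→∞} Σ_{j=1}^{k_n} g(τ_{j-1}ⁿ)·(ω̃(τ_jⁿ) − ω̃(τ_{j-1}ⁿ))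 = Σ_{i=1}^{N} g(t_{i-1})·(ω̃(t_i) − ω̃(t_{i-1})). -/
open Set Filter

theorem aux_Icc_range (F : ℕ → ℕ → ℝ) (m : ℕ) :
    ∑ j ∈ Finset.Icc 1 m, F (j - 1) j = ∑ j ∈ Finset.range m, F j (j + 1) := by
  induction m with
  | zero => simp
  | succ m ih =>
    rw [Finset.sum_Icc_succ_top (by omega), ih, Finset.sum_range_succ]
    simp

/-- Convergence of Riemann–Stieltjes sums with a step-function integrand along a
sequence of partitions `τ n` whose "first point after `t i`" functions `τof n`
converge to `t i` (Step 3 of the proof of Lemma 6). -/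
theorem stmt2 (T : ℝ) (hT : 0 < T) (ωt : ℝ → ℝ)
    (hrc : ∀ x ∈ Set.Ico (0 : ℝ) T, ContinuousWithinAt ωt (Set.Ici x) x)
    (hll : ∀ x ∈ Set.Ioc (0 : ℝ) T, ∃ L : ℝ,
      Tendsto ωt (nhdsWithin x (Set.Iio x)) (nhds L))
    (N : ℕ) (hN : 1 ≤ N) (t : ℕ → ℝ)
    (ht0 : t 0 = 0) (htN : t N = T)
    (htmono : ∀ i j : ℕ, i < j → j ≤ N → t i < t j)
    (g : ℝ → ℝ)
    (hg : ∀ i ∈ Finset.Icc 1 N, ∀ s ∈ Set.Ico (t (i - 1)) (t i), g s = g (t (i - 1)))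
    (k : ℕ → ℕ) (hk : ∀ n, 1 ≤ k n) (τ : ℕ → ℕ → ℝ)
    (hτ0 : ∀ n, τ n 0 = 0) (hτk : ∀ n, τ n (k n) = T)
    (hτmono : ∀ n, ∀ i j : ℕ, i < j → j ≤ k n → τ n i < τ n j)
    (τof : ℕ → ℝ → ℝ)
    (hτof : ∀ n, ∀ s ∈ Set.Icc (0 : ℝ) T,
      (∃ j ≤ k n, τof n s = τ n j) ∧ s ≤ τof n s ∧ ∀ j ≤ k n, s ≤ τ n j → τof n s ≤ τ n j)
    (hconv : ∀ i ∈ Finset.Icc 1 (N - 1),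
      Tendsto (fun n => τof n (t i)) atTop (nhds (t i))) :
    Tendsto
      (fun n => ∑ j ∈ Finset.Icc 1 (k n), g (τ n (j - 1)) * (ωt (τ n j) - ωt (τ n (j - 1))))
      atTop
      (nhds (∑ i ∈ Finset.Icc 1 N, g (t (i - 1)) * (ωt (t i) - ωt (t (i - 1))))) := by
  have htm : ∀ i j : ℕ, i ≤ j → j ≤ N → t i ≤ t j := by
    intro i j h hj
    rcases h.lt_or_eq with h | h
    · exact (htmono i j h hj).le
    · rw [h]
  have htI : ∀ i ≤ N, t i ∈ Set.Icc (0 : ℝ) T := by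
    intro i hi
    exact ⟨ht0 ▸ htm 0 i (Nat.zero_le _) hi, htN ▸ htm i N hi le_rfl⟩
  have hτm : ∀ n, ∀ i j : ℕ, i ≤ j → j ≤ k n → τ n i ≤ τ n j := by
    intro n i j h hj
    rcases h.lt_or_eq with h | h
    · exact (hτmono n i j h hj).le
    · rw [h]
  -- limits
  have h0 : ∀ n, τof n (t 0) = 0 := by
    intro n
    obtain ⟨-, h2, h3⟩ := hτof n (t 0) (htI 0 (Nat.zero_le _))
    have := h3 0 (Nat.zero_le _) (by rw [hτ0, ht0])
    rw [hτ0] at this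
    rw [ht0] at h2 this ⊢
    exact le_antisymm this h2
  have hNN : ∀ n, τof n (t N) = T := by
    intro n
    obtain ⟨-, h2, h3⟩ := hτof n (t N) (htI N le_rfl)
    have := h3 (k n) le_rfl (by rw [hτk, htN])
    rw [hτk] at this
    rw [htN] at h2 this ⊢
    exact le_antisymm this h2
  have hlim : ∀ i ≤ N, Tendsto (fun n => ωt (τof n (t i))) atTop (nhds (ωt (t i))) := by
    intro i hi
    rcases Nat.eq_zero_or_pos i with rfl | hpos
    · simp only [h0]; rw [ht0]; exact tendsto_const_nhds
    rcases hi.eq_or_lt with rfl | hlt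
    · simp only [hNN]; rw [htN]; exact tendsto_const_nhds
    have hc := hrc (t i) ⟨(htI i hi).1, htN ▸ htmono i N hlt le_rfl⟩
    refine Tendsto.comp hc (tendsto_nhdsWithin_iff.2 ⟨hconv i (Finset.mem_Icc.2 ⟨hpos, by omega⟩), ?_⟩)
    exact Eventually.of_forall fun n => (hτof n (t i) (htI i hi)).2.1
  -- exact identity
  have hid : ∀ n, ∑ j ∈ Finset.Icc 1 (k n), g (τ n (j - 1)) * (ωt (τ n j) - ωt (τ n (j - 1)))
      = ∑ i ∈ Finset.Icc 1 N, g (t (i - 1)) * (ωt (τof n (t i)) - ωt (τof n (t (i - 1)))) := by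
    intro n
    rw [aux_Icc_range (fun a b => g (τ n a) * (ωt (τ n b) - ωt (τ n a))),
      aux_Icc_range (fun a b => g (t a) * (ωt (τof n (t b)) - ωt (τof n (t a))))]
    have key : ∀ m ≤ N, ∀ q ≤ k n, τof n (t m) = τ n q →
        ∑ j ∈ Finset.range q, g (τ n j) * (ωt (τ n (j + 1)) - ωt (τ n j))
        = ∑ i ∈ Finset.range m, g (t i) * (ωt (τof n (t (i + 1))) - ωt (τof n (t i))) := by
      intro m
      induction m with
      | zero =>
        intro _ q hq h
        have : q = 0 := by
          by_contra hne
          have := hτmono n 0 q (by omega) hq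
          rw [hτ0, ← h, h0] at this
          exact lt_irrefl _ this
        subst this
        simp
      | succ m ih =>
        intro hm q hq h
        obtain ⟨⟨p, hp, hpe⟩, h2, h3⟩ := hτof n (t m) (htI m (by omega))
        obtain ⟨-, h2', h3'⟩ := hτof n (t (m + 1)) (htI (m + 1) hm)
        have hpq : p ≤ q := by
          by_contra hlt
          have h4 := hτmono n q p (by omega) hp
          have h5 := h3 q hq (by rw [← h]; exact (htm m (m + 1) (by omega) hm).trans h2')
          linarith
        rw [Finset.sum_range_succ, ← ih (by omega) p hp hpe,
          ← Finset.sum_range_add_sum_Ico _ hpq, h, hpe]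
        congr 1
        have : ∀ j ∈ Finset.Ico p q, g (τ n j) * (ωt (τ n (j + 1)) - ωt (τ n j))
            = g (t m) * (ωt (τ n (j + 1)) - ωt (τ n j)) := by
          intro j hj
          rw [Finset.mem_Ico] at hj
          have := hg (m + 1) (Finset.mem_Icc.2 ⟨by omega, hm⟩) (τ n j) ⟨?_, ?_⟩
          · rw [this]; simp
          · have := hτm n p j hj.1 (by omega)
            simp only [Nat.add_sub_cancel]
            linarith
          · by_contra hge
            have h6 := h3' j (by omega) (not_lt.1 hge)
            have := hτmono n j q hj.2 hq
            linarith
        rw [Finset.sum_congr rfl this, ← Finset.mul_sum,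
          Finset.sum_Ico_sub (fun j => ωt (τ n j)) hpq]
    exact key N le_rfl (k n) le_rfl (by rw [hNN, hτk])
  simp only [hid]
  refine tendsto_finsetSum _ fun i hi => ?_
  rw [Finset.mem_Icc] at hi
  exact ((hlim i hi.2).sub (hlim (i - 1) (by omega))).const_mul _
end

section
/- Let T > 0, let ω : [0,T] → ℝ be càdlàg, and let μ₁, μ₂ be finite Borel measures on (0,T]. Define ω̃ : [0,T] → ℝ by ω̃(t) := ω̃(0) + μ₁((0,t]) − μ₂((0,t]) for some fixed ω̃(0) ∈ ℝ (so ω̃ is càdlàg of finite total variation). For each n ∈ ℕ let τⁿ = {0 = τ_0ⁿ < τ_1ⁿ < … < τ_{k_n}ⁿ = T} be a finite partition of [0,T], and write τⁿ(t) := min{ τ_jⁿ : τ_jⁿ ≥ t }. Assume that for every t ∈ (0,T), limsup_{n→∞} τⁿ(t) ≤ inf{ u ∈ (t,T] : ω(u) ≠ ω(t−) } (with inf ∅ := +∞). If the limit L := lim_{n→∞} Σ_{j=1}^{k_n} ω(τ_{j-1}ⁿ)·(ω̃(τ_jⁿ) − ω̃(τ_{j-1}ⁿ)) exists in ℝ,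 then L = ∫_{(0,T]} ω(t−) dμ₁(t) − ∫_{(0,T]} ω(t−) dμ₂(t). -/
open Set Filter MeasureTheory

theorem aux_bdd (T : ℝ) (ω : ℝ → ℝ)
    (hrc : ∀ x ∈ Set.Ico (0 : ℝ) T, ContinuousWithinAt ω (Set.Ici x) x)
    (ωm : ℝ → ℝ)
    (hll : ∀ x ∈ Set.Ioc (0 : ℝ) T,
      Tendsto ω (nhdsWithin x (Set.Iio x)) (nhds (ωm x))) :
    ∃ C, ∀ x ∈ Icc 0 T, |ω x| ≤ C := by
  refine isCompact_Icc.induction_on (p := fun s => ∃ C, ∀ x ∈ s, |ω x| ≤ C) ?_ ?_ ?_ ?_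
  · exact ⟨0, by simp⟩
  · rintro s t hst ⟨C, hC⟩
    exact ⟨C, fun x hx => hC x (hst hx)⟩
  · rintro s t ⟨C, hC⟩ ⟨D, hD⟩
    refine ⟨max C D, ?_⟩
    rintro x (hx | hx)
    · exact (hC x hx).trans (le_max_left _ _)
    · exact (hD x hx).trans (le_max_right _ _)
  · intro x hx
    have h1 : ∃ C, ∀ᶠ y in nhdsWithin x (Icc 0 T), y < x → |ω y| ≤ C := by
      by_cases h0 : 0 < x
      · refine ⟨|ωm x| + 1, ?_⟩
        have h := (hll x ⟨h0, hx.2⟩).abs.eventually_le_const (lt_add_one _)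
        exact (eventually_nhdsWithin_iff.1 h).filter_mono nhdsWithin_le_nhds
      · refine ⟨0, ?_⟩
        filter_upwards [self_mem_nhdsWithin] with y hy hyx
        linarith [hy.1]
    have h2 : ∃ C, ∀ᶠ y in nhdsWithin x (Icc 0 T), x ≤ y → |ω y| ≤ C := by
      by_cases h0 : x < T
      · refine ⟨|ω x| + 1, ?_⟩
        have h := (hrc x ⟨hx.1, h0⟩).tendsto.abs.eventually_le_const (lt_add_one _)
        exact (eventually_nhdsWithin_iff.1 h).filter_mono nhdsWithin_le_nhds
      · refine ⟨|ω T|, ?_⟩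
        filter_upwards [self_mem_nhdsWithin] with y hy hyx
        have : y = T := le_antisymm hy.2 (by linarith)
        rw [this]
    obtain ⟨C, hC⟩ := h1
    obtain ⟨D, hD⟩ := h2
    refine ⟨_, hC.and hD, max C D, ?_⟩
    rintro y ⟨h1, h2⟩
    rcases lt_or_ge y x with h | h
    · exact (h1 h).trans (le_max_left _ _)
    · exact (h2 h).trans (le_max_right _ _)

theorem aux_pt (T : ℝ) (ω : ℝ → ℝ)
    (hrc : ∀ x ∈ Set.Ico (0 : ℝ) T, ContinuousWithinAt ω (Set.Ici x) x)
    (ωm : ℝ → ℝ)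
    (hll : ∀ x ∈ Set.Ioc (0 : ℝ) T,
      Tendsto ω (nhdsWithin x (Set.Iio x)) (nhds (ωm x)))
    (t : ℝ) (ht : t ∈ Ioc 0 T) (σ : ℕ → ℝ) (hσ0 : ∀ n, 0 ≤ σ n) (hσt : ∀ n, σ n < t)
    (key : ∀ s, 0 < s → s < t → (∃ᶠ n in atTop, σ n < s) → ∀ u ∈ Ioo s t, ω u = ωm s) :
    Tendsto (fun n => ω (σ n)) atTop (nhds (ωm t)) := by
  have key2 : ∀ s, 0 < s → s < t → (∃ᶠ n in atTop, σ n < s) →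
      ωm s = ωm t ∧ ∀ u ∈ Ioo s t, ω u = ωm t := by
    intro s h0 hst hf
    have hk := key s h0 hst hf
    have h1 : Tendsto ω (nhdsWithin t (Iio t)) (nhds (ωm s)) := by
      refine tendsto_const_nhds.congr' ?_
      filter_upwards [Ioo_mem_nhdsLT hst] with u hu
      exact (hk u hu).symm
    have h2 := tendsto_nhds_unique h1 (hll t ht)
    exact ⟨h2, fun u hu => h2 ▸ hk u hu⟩
  refine tendsto_of_subseq_tendsto fun ns hns => ?_
  obtain ⟨a, ha, φ, hφ, hlimφ⟩ := (isCompact_Icc (a := (0:ℝ)) (b := t)).tendsto_subseq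
    (x := fun n => σ (ns n)) (fun n => ⟨hσ0 _, (hσt _).le⟩)
  refine ⟨φ, ?_⟩
  have hfreq : ∀ s, (∃ᶠ n in atTop, σ (ns (φ n)) < s) → ∃ᶠ n in atTop, σ n < s :=
    fun s h => (hns.comp hφ.tendsto_atTop).frequently h
  rcases eq_or_lt_of_le ha.2 with hat | hat
  · subst hat
    refine (hll a ht).comp (tendsto_nhdsWithin_iff.2 ⟨hlimφ, Eventually.of_forall fun n => hσt _⟩)
  · have hc : ∀ u ∈ Ioo a t, ω u = ωm t := by
      intro u hu
      obtain ⟨s, h1, h2⟩ := exists_between hu.1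
      refine (key2 s (ha.1.trans_lt h1) (h2.trans hu.2) (hfreq s ?_)).2 u ⟨h2, hu.2⟩
      exact (hlimφ.eventually_lt_const h1).frequently
    have hca : ω a = ωm t := by
      have h1 : Tendsto ω (nhdsWithin a (Ioi a)) (nhds (ω a)) :=
        (hrc a ⟨ha.1, hat.trans_le ht.2⟩).mono_left (nhdsWithin_mono _ Ioi_subset_Ici_self)
      have h2 : Tendsto ω (nhdsWithin a (Ioi a)) (nhds (ωm t)) := by
        refine tendsto_const_nhds.congr' ?_
        filter_upwards [Ioo_mem_nhdsGT hat] with u hu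
        exact (hc u hu).symm
      exact tendsto_nhds_unique h1 h2
    have hc' : ∀ u, a ≤ u → u < t → ω u = ωm t := by
      intro u h1 h2
      rcases eq_or_lt_of_le h1 with h | h
      · rw [← h, hca]
      · exact hc u ⟨h, h2⟩
    by_cases hf : ∃ᶠ n in atTop, σ (ns (φ n)) < a
    · obtain ⟨m, hm⟩ := hf.exists
      have h0 : 0 < a := (hσ0 _).trans_lt hm
      have hma := (key2 a h0 hat (hfreq a hf)).1
      have hl := hll a ⟨h0, hat.le.trans ht.2⟩
      rw [hma] at hl
      rw [tendsto_def] at hl ⊢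
      intro U hU
      have h3 := hlimφ.eventually (eventually_nhdsWithin_iff.1 (hl U hU))
      filter_upwards [h3] with n hn
      rcases lt_or_ge (σ (ns (φ n))) a with h | h
      · exact hn h
      · change ω (σ (ns (φ n))) ∈ U
        rw [hc' _ h (hσt _)]
        exact mem_of_mem_nhds hU
    · refine tendsto_const_nhds.congr' ?_
      filter_upwards [not_frequently.1 hf] with n hn
      exact (hc' _ (not_lt.1 hn) (hσt _)).symm

/-- Lemma 6 of the paper: if the Föllmer-type Riemann–Stieltjes sums of the càdlàg path
`ω` against the finite-variation integrator `ω̃ (s) = ω̃(0) + μ₁((0,s]) − μ₂((0,s])`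
converge along partitions `τ n` satisfying the Lebesgue-partition property
`limsup_n τⁿ(t) ≤ inf { u ∈ (t,T] : ω u ≠ ω(t−) }`, then the limit equals the
Lebesgue–Stieltjes integral `∫_{(0,T]} ω(t−) dμ₁ − ∫_{(0,T]} ω(t−) dμ₂`. -/
theorem stmt3 (T : ℝ) (hT : 0 < T) (ω : ℝ → ℝ)
    (hrc : ∀ x ∈ Set.Ico (0 : ℝ) T, ContinuousWithinAt ω (Set.Ici x) x)
    (ωm : ℝ → ℝ)
    (hll : ∀ x ∈ Set.Ioc (0 : ℝ) T,
      Tendsto ω (nhdsWithin x (Set.Iio x)) (nhds (ωm x)))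
    (μ₁ μ₂ : Measure ℝ) [IsFiniteMeasure μ₁] [IsFiniteMeasure μ₂]
    (hμ₁ : μ₁ (Set.Ioc (0 : ℝ) T)ᶜ = 0) (hμ₂ : μ₂ (Set.Ioc (0 : ℝ) T)ᶜ = 0)
    (ωt0 : ℝ) (ωt : ℝ → ℝ)
    (hωt : ∀ s : ℝ, ωt s = ωt0 + (μ₁ (Set.Ioc 0 s)).toReal - (μ₂ (Set.Ioc 0 s)).toReal)
    (k : ℕ → ℕ) (hk : ∀ n, 1 ≤ k n) (τ : ℕ → ℕ → ℝ)
    (hτ0 : ∀ n, τ n 0 = 0) (hτk : ∀ n, τ n (k n) = T)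
    (hτmono : ∀ n, ∀ i j : ℕ, i < j → j ≤ k n → τ n i < τ n j)
    (τof : ℕ → ℝ → ℝ)
    (hτof : ∀ n, ∀ s ∈ Set.Icc (0 : ℝ) T,
      (∃ j ≤ k n, τof n s = τ n j) ∧ s ≤ τof n s ∧ ∀ j ≤ k n, s ≤ τ n j → τof n s ≤ τ n j)
    (hlim : ∀ s ∈ Set.Ioo (0 : ℝ) T,
      Filter.limsup (fun n => ((τof n s : ℝ) : EReal)) atTop ≤
        sInf {x : EReal | ∃ u : ℝ, x = (u : EReal) ∧ u ∈ Set.Ioc s T ∧ ω u ≠ ωm s})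
    (L : ℝ)
    (hL : Tendsto
      (fun n => ∑ j ∈ Finset.Icc 1 (k n), ω (τ n (j - 1)) * (ωt (τ n j) - ωt (τ n (j - 1))))
      atTop (nhds L)) :
    L = (∫ s in Set.Ioc (0 : ℝ) T, ωm s ∂μ₁) - ∫ s in Set.Ioc (0 : ℝ) T, ωm s ∂μ₂ := by
  obtain ⟨C, hC⟩ := aux_bdd T ω hrc ωm hll
  have hmono : ∀ n, ∀ i j : ℕ, i ≤ j → j ≤ k n → τ n i ≤ τ n j := by
    intro n i j hij hj
    rcases eq_or_lt_of_le hij with h | h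
    · rw [h]
    · exact (hτmono n i j h hj).le
  set F : ℕ → ℝ → ℝ := fun n t => ∑ j ∈ Finset.Icc 1 (k n),
    (Ioc (τ n (j - 1)) (τ n j)).indicator (fun _ => ω (τ n (j - 1))) t with hF
  have hex : ∀ n, ∀ t ∈ Ioc 0 T, ∃ j, 1 ≤ j ∧ j ≤ k n ∧ τ n (j-1) < t ∧ t ≤ τ n j ∧
      F n t = ω (τ n (j-1)) := by
    intro n t ht
    have he : ∃ j, t ≤ τ n j := ⟨k n, by rw [hτk]; exact ht.2⟩
    classical
    have hs := Nat.find_spec he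
    have hmin := fun m => Nat.find_min (H := he) (m := m)
    have hle : Nat.find he ≤ k n := Nat.find_min' he (by rw [hτk]; exact ht.2)
    generalize Nat.find he = j at hs hmin hle
    have hj1 : 1 ≤ j := by
      rcases Nat.eq_zero_or_pos j with h | h
      · rw [h, hτ0] at hs
        exact absurd hs (not_le.2 ht.1)
      · exact h
    have hlt : τ n (j-1) < t := not_le.1 (hmin (j-1) (by omega))
    refine ⟨j, hj1, hle, hlt, hs, ?_⟩
    simp only [hF]
    rw [Finset.sum_eq_single j]
    · rw [indicator_of_mem (show t ∈ Ioc (τ n (j - 1)) (τ n j) from ⟨hlt, hs⟩)]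
    · intro i hi hij
      rw [Finset.mem_Icc] at hi
      apply indicator_of_notMem
      rintro ⟨h1, h2⟩
      rcases lt_or_gt_of_ne hij with h | h
      · exact hmin i h h2
      · have := hmono n j (i-1) (by omega) (by omega)
        linarith
    · intro h
      exact absurd (Finset.mem_Icc.2 ⟨hj1, hle⟩) h
  have hFlim : ∀ t ∈ Ioc 0 T, Tendsto (fun n => F n t) atTop (nhds (ωm t)) := by
    intro t ht
    choose J hJ1 hJk hJlt hJle hJF using fun n => hex n t ht
    simp only [hJF]
    refine aux_pt T ω hrc ωm hll t ht (fun n => τ n (J n - 1)) ?_ hJlt ?_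
    · intro n
      have := hmono n 0 (J n - 1) (Nat.zero_le _) (by have := hJk n; omega)
      rwa [hτ0] at this
    · intro s h0 hst hf u hu
      by_contra hne
      have hsT : s < T := hst.trans_le ht.2
      have h1 := hlim s ⟨h0, hsT⟩
      have h2 : ((t : ℝ) : EReal) ≤ limsup (fun n => ((τof n s : ℝ) : EReal)) atTop := by
        refine le_limsup_of_frequently_le (hf.mono ?_)
        intro n hn
        obtain ⟨⟨i, hik, hi⟩, h3, -⟩ := hτof n s ⟨h0.le, hsT.le⟩
        rw [EReal.coe_le_coe_iff, hi]
        rw [hi] at h3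
        refine (hJle n).trans ?_
        by_contra hcon
        have hiJ : i < J n := by
          by_contra h
          exact hcon (hmono n _ _ (not_lt.1 h) hik)
        have := hmono n i (J n - 1) (by omega) (by have := hJk n; omega)
        linarith
      have h3 : sInf {x : EReal | ∃ u : ℝ, x = (u : EReal) ∧ u ∈ Set.Ioc s T ∧ ω u ≠ ωm s} ≤
          (u : EReal) := sInf_le ⟨u, rfl, ⟨hu.1, hu.2.le.trans ht.2⟩, hne⟩
      have h4 := (h2.trans h1).trans h3
      rw [EReal.coe_le_coe_iff] at h4
      linarith [hu.2]
  have hτnn : ∀ n j, j ≤ k n → 0 ≤ τ n j := by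
    intro n j hj
    have := hmono n 0 j (Nat.zero_le _) hj
    rwa [hτ0] at this
  have hτT : ∀ n j, j ≤ k n → τ n j ≤ T := by
    intro n j hj
    have := hmono n j (k n) hj le_rfl
    rwa [hτk] at this
  have hFbd : ∀ n, ∀ t ∈ Ioc 0 T, ‖F n t‖ ≤ C := by
    intro n t ht
    obtain ⟨j, h1, h2, h3, h4, h5⟩ := hex n t ht
    rw [h5]
    exact hC _ ⟨hτnn n _ (by omega), hτT n _ (by omega)⟩
  have hint : ∀ (μ : Measure ℝ) [IsFiniteMeasure μ],
      Tendsto (fun n => ∫ t in Ioc 0 T, F n t ∂μ) atTop (nhds (∫ t in Ioc 0 T, ωm t ∂μ)) := by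
    intro μ _
    refine tendsto_integral_of_dominated_convergence (fun _ => C) ?_ (integrable_const _) ?_ ?_
    · intro n
      refine Measurable.aestronglyMeasurable ?_
      refine Finset.measurable_sum _ fun j _ => ?_
      exact measurable_const.indicator measurableSet_Ioc
    · intro n
      exact (ae_restrict_iff' measurableSet_Ioc).2 (Eventually.of_forall (hFbd n))
    · exact (ae_restrict_iff' measurableSet_Ioc).2 (Eventually.of_forall hFlim)
  have hinc : ∀ (μ : Measure ℝ) [IsFiniteMeasure μ], ∀ a b, 0 ≤ a → a ≤ b →
      μ.real (Ioc a b) = (μ (Ioc 0 b)).toReal - (μ (Ioc 0 a)).toReal := by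
    intro μ _ a b h0 hab
    have : μ.real (Ioc 0 a ∪ Ioc a b) = μ.real (Ioc 0 a) + μ.real (Ioc a b) :=
      measureReal_union (Ioc_disjoint_Ioc_of_le le_rfl) measurableSet_Ioc
    rw [Ioc_union_Ioc_eq_Ioc h0 hab] at this
    simp only [Measure.real] at this ⊢
    linarith
  have hsum : ∀ (μ : Measure ℝ) [IsFiniteMeasure μ], ∀ n,
      ∫ t in Ioc 0 T, F n t ∂μ = ∑ j ∈ Finset.Icc 1 (k n), ω (τ n (j - 1)) *
        ((μ (Ioc 0 (τ n j))).toReal - (μ (Ioc 0 (τ n (j-1)))).toReal) := by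
    intro μ _ n
    simp only [hF]
    rw [integral_finsetSum]
    · refine Finset.sum_congr rfl fun j hj => ?_
      rw [Finset.mem_Icc] at hj
      have hsub : Ioc (τ n (j-1)) (τ n j) ⊆ Ioc 0 T :=
        Ioc_subset_Ioc (hτnn n _ (by omega)) (hτT n _ hj.2)
      rw [integral_indicator measurableSet_Ioc, Measure.restrict_restrict measurableSet_Ioc,
        inter_eq_self_of_subset_left hsub, setIntegral_const, smul_eq_mul,
        hinc μ _ _ (hτnn n _ (by omega)) (hmono n _ _ (by omega) hj.2), mul_comm]
    · intro j _
      exact (integrable_const _).indicator measurableSet_Ioc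
  refine tendsto_nhds_unique hL (((hint μ₁).sub (hint μ₂)).congr fun n => ?_)
  rw [hsum μ₁, hsum μ₂, ← Finset.sum_sub_distrib]
  refine Finset.sum_congr rfl fun j _ => ?_
  rw [hωt, hωt]
  ring
end

section
/- Let T > 0 and let ω : [0,T] → ℝ be continuous. Then there exists a sequence (πⁿ)_{n∈ℕ} of finite partitions of [0,T], each containing 0 and T and each refining the previous one (πⁿ ⊆ πⁿ⁺¹), such that the discrete quadratic variations along πⁿ tend to 0: writing πⁿ = {0 = t_0ⁿ < t_1ⁿ < … < t_{m_n}ⁿ = T}, one has lim_{n→∞} Σ_{k=1}^{m_n} (ω(t_kⁿ) − ω(t_{k-1}ⁿ))² = 0. -/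
open Set Filter

lemma aux_mid (T : ℝ) (ω : ℝ → ℝ) (hω : ContinuousOn ω (Set.Icc 0 T)) (a b δ : ℝ)
    (ha : 0 ≤ a) (hab : a < b) (hb : b ≤ T) (hδ : 0 < δ) :
    ∃ c, a < c ∧ c < b ∧ |ω c - (ω a + ω b) / 2| ≤ δ := by
  have hc : ContinuousOn ω (Set.Icc a b) := hω.mono (Set.Icc_subset_Icc ha hb)
  rcases lt_trichotomy (ω a) (ω b) with h | h | h
  · obtain ⟨c, hc1, hc2⟩ := intermediate_value_Ioo hab.le hc
      (show (ω a + ω b) / 2 ∈ Set.Ioo (ω a) (ω b) from ⟨by linarith, by linarith⟩)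
    exact ⟨c, hc1.1, hc1.2, by rw [hc2]; simpa using hδ.le⟩
  · have h1 := hc a ⟨le_rfl, hab.le⟩
    rw [Metric.continuousWithinAt_iff] at h1
    obtain ⟨η, hη, h2⟩ := h1 δ hδ
    have hm : 0 < min η (b - a) := lt_min hη (by linarith)
    have hm1 := min_le_left η (b - a)
    have hm2 := min_le_right η (b - a)
    refine ⟨a + min η (b - a) / 2, by linarith, by linarith, ?_⟩
    have h3 := h2 (x := a + min η (b - a) / 2) ⟨by linarith, by linarith⟩ (by
      rw [Real.dist_eq, add_sub_cancel_left, abs_of_pos (by linarith)]; linarith)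
    rw [Real.dist_eq] at h3
    rw [← h, add_self_div_two]
    exact h3.le
  · obtain ⟨c, hc1, hc2⟩ := intermediate_value_Ioo' hab.le hc
      (show (ω a + ω b) / 2 ∈ Set.Ioo (ω b) (ω a) from ⟨by linarith, by linarith⟩)
    exact ⟨c, hc1.1, hc1.2, by rw [hc2]; simpa using hδ.le⟩

noncomputable def auxT (T : ℝ) (c : ℝ → ℝ → ℝ → ℝ) : ℕ → ℕ → ℝ
  | 0, k => if k = 0 then 0 else T
  | n + 1, k => if k % 2 = 0 then auxT T c n (k / 2)
      else c (auxT T c n (k / 2)) (auxT T c n (k / 2 + 1)) (1 / 2 ^ (n + 1))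

lemma aux_mono (f : ℕ → ℝ) (m : ℕ) (h : ∀ k < m, f k < f (k + 1)) :
    ∀ i j : ℕ, i < j → j ≤ m → f i < f j := by
  intro i j hij
  induction j, hij using Nat.le_induction with
  | base => intro hj; exact h i hj
  | succ j hij ih => intro hj; exact (ih (by omega)).trans (h j hj)

lemma aux_even (T : ℝ) (c : ℝ → ℝ → ℝ → ℝ) (n k : ℕ) :
    auxT T c (n + 1) (2 * k) = auxT T c n k := by
  simp [auxT]

lemma aux_odd (T : ℝ) (c : ℝ → ℝ → ℝ → ℝ) (n k : ℕ) :
    auxT T c (n + 1) (2 * k + 1) =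
      c (auxT T c n k) (auxT T c n (k + 1)) (1 / 2 ^ (n + 1)) := by
  have h1 : (2 * k + 1) % 2 = 1 := by omega
  have h2 : (2 * k + 1) / 2 = k := by omega
  simp [auxT, h1, h2]

/-- For any continuous `ω : [0,T] → ℝ` there is a refining sequence of finite partitions
of `[0,T]` (each containing `0` and `T`) along which the discrete quadratic variation
tends to `0` (Section 3.4 of the paper, via the Darboux property). -/
theorem stmt6 (T : ℝ) (hT : 0 < T) (ω : ℝ → ℝ)
    (hω : ContinuousOn ω (Set.Icc 0 T)) :
    ∃ (m : ℕ → ℕ) (t : ℕ → ℕ → ℝ),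
      (∀ n, t n 0 = 0) ∧ (∀ n, t n (m n) = T) ∧
      (∀ n, ∀ i j : ℕ, i < j → j ≤ m n → t n i < t n j) ∧
      (∀ n, (Finset.Icc 0 (m n)).image (t n) ⊆ (Finset.Icc 0 (m (n + 1))).image (t (n + 1))) ∧
      Tendsto (fun n => ∑ k ∈ Finset.Icc 1 (m n), (ω (t n k) - ω (t n (k - 1))) ^ 2)
        atTop (nhds 0) := by
  have key : ∀ a b δ : ℝ, ∃ c, 0 ≤ a → a < b → b ≤ T → 0 < δ →
      a < c ∧ c < b ∧ |ω c - (ω a + ω b) / 2| ≤ δ := by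
    intro a b δ
    by_cases h : 0 ≤ a ∧ a < b ∧ b ≤ T ∧ 0 < δ
    · obtain ⟨c, hc⟩ := aux_mid T ω hω a b δ h.1 h.2.1 h.2.2.1 h.2.2.2
      exact ⟨c, fun _ _ _ _ => hc⟩
    · exact ⟨0, fun h1 h2 h3 h4 => absurd ⟨h1, h2, h3, h4⟩ h⟩
  choose c hc using key
  set t := auxT T c with ht
  have he : ∀ n k, t (n + 1) (2 * k) = t n k := aux_even T c
  have ho : ∀ n k, t (n + 1) (2 * k + 1) = c (t n k) (t n (k + 1)) (1 / 2 ^ (n + 1)) :=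
    aux_odd T c
  have h0 : ∀ n, t n 0 = 0 := by
    intro n
    induction n with
    | zero => simp [ht, auxT]
    | succ n ih => rw [← ih]; exact he n 0
  have h1 : ∀ n, t n (2 ^ n) = T := by
    intro n
    induction n with
    | zero => simp [ht, auxT]
    | succ n ih => rw [pow_succ', he, ih]
  set C := |ω T - ω 0| with hC
  have hstep : ∀ n, ∀ k < 2 ^ n, t n k < t n (k + 1) ∧
      |ω (t n (k + 1)) - ω (t n k)| ≤ (C + n) / 2 ^ n := by
    intro n
    induction n with
    | zero =>
      intro k hk
      have : k = 0 := by simpa using hk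
      subst this
      simp [ht, auxT, hT, hC]
    | succ n ih =>
      have hm := aux_mono (t n) (2 ^ n) (fun k hk => (ih k hk).1)
      intro k hk
      rw [pow_succ'] at hk
      have main : ∀ j < 2 ^ n, _ := fun j hj => hc (t n j) (t n (j + 1)) (1 / 2 ^ (n + 1))
        (by
          rcases Nat.eq_zero_or_pos j with h | h
          · rw [h, h0]
          · have := hm 0 j h hj.le
            rw [h0] at this; exact this.le)
        (ih j hj).1
        (by
          rcases Nat.lt_or_ge (j + 1) (2 ^ n) with h | h
          · have := hm (j + 1) (2 ^ n) h le_rfl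
            rw [h1] at this; exact this.le
          · have : j + 1 = 2 ^ n := by omega
            rw [this, h1])
        (by positivity)
      have hb : (C + ((n + 1 : ℕ) : ℝ)) / 2 ^ (n + 1) = (C + n) / 2 ^ n / 2 + 1 / 2 ^ (n + 1) := by
        push_cast; field_simp; ring
      rw [hb]
      rcases Nat.even_or_odd' k with ⟨j, rfl | rfl⟩
      · obtain ⟨m1, m2, m3⟩ := main j (by omega)
        have i2 := (ih j (by omega)).2
        rw [he, ho]
        refine ⟨m1, ?_⟩
        rw [abs_le] at *
        constructor <;> linarith [m3.1, m3.2, i2.1, i2.2]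
      · obtain ⟨m1, m2, m3⟩ := main j (by omega)
        have i2 := (ih j (by omega)).2
        rw [show 2 * j + 1 + 1 = 2 * (j + 1) by ring, he, ho]
        refine ⟨m2, ?_⟩
        rw [abs_le] at *
        constructor <;> linarith [m3.1, m3.2, i2.1, i2.2]
  refine ⟨fun n => 2 ^ n, t, h0, h1,
    fun n => aux_mono (t n) (2 ^ n) (fun k hk => (hstep n k hk).1), ?_, ?_⟩
  · intro n x hx
    simp only [Finset.mem_image, Finset.mem_Icc] at hx ⊢
    obtain ⟨k, hk, rfl⟩ := hx
    exact ⟨2 * k, ⟨by omega, by rw [pow_succ']; omega⟩, he n k⟩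
  · have hlim : Tendsto (fun n : ℕ => (C + n) ^ 2 / (2 : ℝ) ^ n) atTop (nhds 0) := by
      have a0 := tendsto_pow_const_div_const_pow_of_one_lt 0 (r := (2 : ℝ)) (by norm_num)
      have a1 := tendsto_pow_const_div_const_pow_of_one_lt 1 (r := (2 : ℝ)) (by norm_num)
      have a2 := tendsto_pow_const_div_const_pow_of_one_lt 2 (r := (2 : ℝ)) (by norm_num)
      have := ((a0.const_mul (C ^ 2)).add (a1.const_mul (2 * C))).add a2
      simp only [mul_zero, add_zero] at this
      refine this.congr (fun n => ?_)
      field_simp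
      ring
    refine squeeze_zero (fun n => Finset.sum_nonneg (fun _ _ => sq_nonneg _)) (fun n => ?_) hlim
    calc _ ≤ ∑ k ∈ Finset.Icc 1 (2 ^ n), ((C + n) / (2 : ℝ) ^ n) ^ 2 := by
          refine Finset.sum_le_sum (fun k hk => ?_)
          rw [Finset.mem_Icc] at hk
          have hk2 : k ≤ 2 ^ n := hk.2
          obtain ⟨j, rfl⟩ : ∃ j, k = j + 1 := ⟨k - 1, by omega⟩
          have := (hstep n j (by omega)).2
          rw [Nat.add_sub_cancel, ← sq_abs]
          gcongr
      _ = _ := by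
          simp
          field_simp
end
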